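/- Let X be a smooth extremal surface of degree d = q+1 in ℙ³(k). Then X contains a double 2d: there exist sets A and B, each consisting of 2d lines on X, forming a double 2d. -/

import Mathlib

open Module

/-! Basic setup: `k` is an algebraically closed field of characteristic `p > 0`,
`q = p^e`.  We model ℙ³(k) via linear subspaces of `k⁴ = Fin 4 → k`:
points, lines and planes of ℙ³(k) are subspaces of dimension 1, 2 and 3
respectively.  A hypersurface cut out by a homogeneous form is recorded by its
affine cone in `k⁴`. -/

/-- The Frobenius form in 4 variables determined by a 4×4 matrix `A`:
`∑ i j, A i j * x i ^ q * x j`, a homogeneous form of degree `q+1`. -/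
def frobForm {k : Type*} [Field k] (q : ℕ) (A : Matrix (Fin 4) (Fin 4) k)
    (x : Fin 4 → k) : k :=
  ∑ i, ∑ j, A i j * x i ^ q * x j

/-- The affine cone in `k⁴` of the extremal surface in ℙ³(k) cut out by the
Frobenius form with matrix `A`; a point of ℙ³(k) lies on the surface iff its
homogeneous coordinate representatives lie in this set. -/
def extremalCone (k : Type*) [Field k] (q : ℕ) (A : Matrix (Fin 4) (Fin 4) k) :
    Set (Fin 4 → k) :=
  {x | frobForm q A x = 0}

/-- A point of ℙ³(k): a 1-dimensional subspace of `k⁴`. -/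
def IsPoint {k : Type*} [Field k] (c : Submodule k (Fin 4 → k)) : Prop :=
  finrank k c = 1

/-- A line of ℙ³(k): a 2-dimensional subspace of `k⁴`. -/
def IsLine {k : Type*} [Field k] (L : Submodule k (Fin 4 → k)) : Prop :=
  finrank k L = 2

/-- A plane of ℙ³(k): a 3-dimensional subspace of `k⁴`. -/
def IsPlane {k : Type*} [Field k] (H : Submodule k (Fin 4 → k)) : Prop :=
  finrank k H = 3

/-- `L` is a line lying on the surface with affine cone `X`. -/
def IsLineOn {k : Type*} [Field k] (X : Set (Fin 4 → k))
    (L : Submodule k (Fin 4 → k)) : Prop :=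
  IsLine L ∧ (L : Set (Fin 4 → k)) ⊆ X

/-- Two lines of ℙ³(k) meet iff the corresponding subspaces of `k⁴` intersect
nontrivially. -/
def MeetsLine {k : Type*} [Field k] (L M : Submodule k (Fin 4 → k)) : Prop :=
  L ⊓ M ≠ ⊥

/-- Two lines of ℙ³(k) are skew iff the corresponding subspaces of `k⁴`
intersect trivially. -/
def SkewLine {k : Type*} [Field k] (L M : Submodule k (Fin 4 → k)) : Prop :=
  L ⊓ M = ⊥

/-- `IsStarAt q X S c`: `S` is a star on the surface with affine cone `X`,
centered at the point `c`, i.e. a set of `q+1` distinct lines on the surface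
all passing through `c`. -/
def IsStarAt {k : Type*} [Field k] (q : ℕ) (X : Set (Fin 4 → k))
    (S : Set (Submodule k (Fin 4 → k))) (c : Submodule k (Fin 4 → k)) : Prop :=
  IsPoint c ∧ S.ncard = q + 1 ∧ ∀ L ∈ S, IsLineOn X L ∧ c ≤ L

/-- `S` is a star on the surface with affine cone `X`. -/
def IsStar {k : Type*} [Field k] (q : ℕ) (X : Set (Fin 4 → k))
    (S : Set (Submodule k (Fin 4 → k))) : Prop :=
  ∃ c, IsStarAt q X S c

/-- `c` is a star point of the surface with affine cone `X`. -/
def IsStarPoint {k : Type*} [Field k] (q : ℕ) (X : Set (Fin 4 → k))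
    (c : Submodule k (Fin 4 → k)) : Prop :=
  ∃ S, IsStarAt q X S c

/-- `H` is a star plane of the surface with affine cone `X`, centered at `c`:
the plane section `X ∩ H` is the union of a star centered at `c`. -/
def IsStarPlaneAt {k : Type*} [Field k] (q : ℕ) (X : Set (Fin 4 → k))
    (H c : Submodule k (Fin 4 → k)) : Prop :=
  IsPlane H ∧ ∃ S, IsStarAt q X S c ∧
    X ∩ (H : Set (Fin 4 → k)) = ⋃ L ∈ S, (L : Set (Fin 4 → k))

/-- An element of `Aut(X)`: since every projective linear automorphism of
ℙ³(k) is represented by an invertible linear map of `k⁴` (uniquely up to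
scalars, which act trivially on subspaces and preserve every cone), `g ∈
PGL(4,k)` with `g(X) = X` corresponds to a linear automorphism of `k⁴`
mapping the affine cone `X` onto itself. -/
def PreservesCone {k : Type*} [Field k] (X : Set (Fin 4 → k))
    (g : (Fin 4 → k) ≃ₗ[k] (Fin 4 → k)) : Prop :=
  (⇑g) '' X = X

/-- A double `2d`: a pair of sets `𝒜`, `ℬ`, each consisting of `2d` lines in
ℙ³(k), such that the lines within `𝒜` are pairwise skew, the lines within `ℬ`
are pairwise skew, each line of `𝒜` meets exactly `d+2` lines of `ℬ`, and
each line of `ℬ` meets exactly `d+2` lines of `𝒜`. -/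
def IsDoubleTwoD {k : Type*} [Field k] (d : ℕ)
    (𝒜 ℬ : Set (Submodule k (Fin 4 → k))) : Prop :=
  𝒜.ncard = 2 * d ∧ ℬ.ncard = 2 * d ∧
  (∀ L ∈ 𝒜, IsLine L) ∧ (∀ L ∈ ℬ, IsLine L) ∧
  (∀ L ∈ 𝒜, ∀ M ∈ 𝒜, L ≠ M → SkewLine L M) ∧
  (∀ L ∈ ℬ, ∀ M ∈ ℬ, L ≠ M → SkewLine L M) ∧
  (∀ L ∈ 𝒜, {M ∈ ℬ | MeetsLine L M}.ncard = d + 2) ∧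
  (∀ M ∈ ℬ, {L ∈ 𝒜 | MeetsLine L M}.ncard = d + 2)


section Lang
variable {k V : Type*} [Field k] [IsAlgClosed k] [AddCommGroup V] [Module k V]

/-- Auxiliary polynomials. -/
noncomputable def langPoly (Q : ℕ) (c : ℕ → k) : ℕ → Polynomial k
  | 0 => Polynomial.C (c 0)
  | i + 1 => Polynomial.X ^ (Q * Q - Q) * (langPoly Q c i) ^ Q + Polynomial.C (c (i + 1))

lemma langPoly_ne (Q : ℕ) (hQ : 2 ≤ Q) (c : ℕ → k) (n : ℕ) (h : langPoly Q c n = 0) :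
    ∀ i ≤ n, c i = 0 := by
  have hpos : Q * Q - Q ≠ 0 := by
    have : Q * 2 ≤ Q * Q := Nat.mul_le_mul_left _ hQ
    omega
  induction n with
  | zero =>
    intro i hi
    obtain rfl : i = 0 := by omega
    simpa [langPoly] using h
  | succ n ih =>
    have h0 : c (n + 1) = 0 := by
      have := congrArg (Polynomial.eval 0) h
      simpa [langPoly, hpos] using this
    have h1 : langPoly Q c n = 0 := by
      simp only [langPoly, h0, map_zero, add_zero, mul_eq_zero] at h
      rcases h with h | h
      · exact absurd h (pow_ne_zero _ Polynomial.X_ne_zero)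
      · exact eq_zero_of_pow_eq_zero h
    intro i hi
    rcases Nat.lt_or_ge i (n + 1) with h2 | h2
    · exact ih h1 i (by omega)
    · obtain rfl : i = n + 1 := by omega
      exact h0

lemma lang_seq (Q : ℕ) (hQ : 2 ≤ Q) (c : ℕ → k) (n : ℕ) (h : ∃ i ≤ n, c i ≠ 0) :
    ∃ t : ℕ → k, t n ≠ 0 ∧ t 0 = t n ^ Q * c 0 ∧
      ∀ i, t (i + 1) = t i ^ Q + t n ^ Q * c (i + 1) := by
  have hne : langPoly Q c n ≠ 0 := by
    intro h0
    obtain ⟨i, hi, hc⟩ := h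
    exact hc (langPoly_ne Q hQ c n h0 i hi)
  obtain ⟨T, hT⟩ := IsAlgClosed.exists_root (Polynomial.X ^ (Q - 1) * langPoly Q c n - 1) (by
    have : (Polynomial.X ^ (Q - 1) * langPoly Q c n - 1).natDegree ≠ 0 := by
      rw [← Polynomial.C_1, Polynomial.natDegree_sub_C, Polynomial.natDegree_mul
        (pow_ne_zero _ Polynomial.X_ne_zero) hne, Polynomial.natDegree_X_pow]
      omega
    intro h0
    exact this (Polynomial.natDegree_eq_of_degree_eq_some h0))
  have hT' : T ^ (Q - 1) * (langPoly Q c n).eval T = 1 := by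
    have := hT
    simp only [Polynomial.IsRoot, Polynomial.eval_sub, Polynomial.eval_mul, Polynomial.eval_pow,
      Polynomial.eval_X, Polynomial.eval_one] at this
    linear_combination this
  have hT0 : T ≠ 0 := by
    rintro rfl
    rw [zero_pow (by omega)] at hT'
    simp at hT'
  have hfin : T ^ Q * (langPoly Q c n).eval T = T := by
    have : T ^ Q = T * T ^ (Q - 1) := by rw [← pow_succ']; congr 1; omega
    rw [this, mul_assoc, hT', mul_one]
  refine ⟨fun i => T ^ Q * (langPoly Q c i).eval T, ?_, ?_, ?_⟩
  · simpa only [hfin] using hT0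
  · simp only [hfin]; simp [langPoly]
  · intro i
    simp only [hfin]
    have : T ^ Q * T ^ (Q * Q - Q) = T ^ (Q * Q) := by
      rw [← pow_add]; congr 1
      have : Q * 2 ≤ Q * Q := Nat.mul_le_mul_left _ hQ
      omega
    simp only [langPoly, Polynomial.eval_add, Polynomial.eval_mul, Polynomial.eval_pow,
      Polynomial.eval_X, Polynomial.eval_C, mul_pow, ← pow_mul]
    linear_combination (Polynomial.eval T (langPoly Q c i)) ^ Q * this

lemma exists_pow_sub (Q : ℕ) (hQ : 2 ≤ Q) (b s : k) : ∃ t : k, t ^ Q + b * t = s := by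
  obtain ⟨t, ht⟩ := IsAlgClosed.exists_root
    (Polynomial.X ^ Q + (Polynomial.C b * Polynomial.X - Polynomial.C s)) (by
    rw [Polynomial.degree_add_eq_left_of_degree_lt]
    · simp; omega
    · rw [Polynomial.degree_X_pow]
      refine lt_of_le_of_lt (b := ((1 : ℕ) : WithBot ℕ)) ?_ (by exact_mod_cast hQ)
      compute_degree; norm_num)
  refine ⟨t, ?_⟩
  simp only [Polynomial.IsRoot, Polynomial.eval_sub, Polynomial.eval_add, Polynomial.eval_mul,
    Polynomial.eval_pow, Polynomial.eval_X, Polynomial.eval_C] at ht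
  linear_combination ht

variable (σ : k →+* k) (φ : V →ₛₗ[σ] V)

lemma lang_pre (hs : Function.Surjective σ) (hφ : Function.Injective φ) (u : V)
    (hu : φ u ∈ Submodule.span k {x | φ x = x}) : u ∈ Submodule.span k {x | φ x = x} := by
  have key : ∀ w ∈ Submodule.span k {x | φ x = x},
      ∃ w' ∈ Submodule.span k {x | φ x = x}, φ w' = w := by
    intro w hw
    induction hw using Submodule.span_induction with
    | mem x hx => exact ⟨x, Submodule.subset_span hx, hx⟩
    | zero => exact ⟨0, Submodule.zero_mem _, map_zero _⟩
    | add x y _ _ hx hy =>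
      obtain ⟨x', hx', rfl⟩ := hx
      obtain ⟨y', hy', rfl⟩ := hy
      exact ⟨x' + y', Submodule.add_mem _ hx' hy', map_add _ _ _⟩
    | smul a x _ hx =>
      obtain ⟨x', hx', rfl⟩ := hx
      obtain ⟨b, rfl⟩ := hs a
      exact ⟨b • x', Submodule.smul_mem _ _ hx', by simp⟩
  obtain ⟨w', hw', h⟩ := key _ hu
  exact hφ h ▸ hw'

lemma lang_solve (Q : ℕ) (hQ : 2 ≤ Q) (hσ : ∀ x, σ x = x ^ Q) (w : V)
    (hw : w ∈ Submodule.span k {x | φ x = x}) :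
    ∃ u ∈ Submodule.span k {x | φ x = x}, φ u - u = w := by
  induction hw using Submodule.closure_induction with
  | zero => exact ⟨0, Submodule.zero_mem _, by simp⟩
  | add x y _ _ hx hy =>
    obtain ⟨x', hx', rfl⟩ := hx
    obtain ⟨y', hy', rfl⟩ := hy
    exact ⟨x' + y', Submodule.add_mem _ hx' hy', by rw [map_add]; abel⟩
  | smul_mem a x hx =>
    obtain ⟨t, ht⟩ := exists_pow_sub Q hQ (-1) a
    refine ⟨t • x, Submodule.smul_mem _ _ (Submodule.subset_span hx), ?_⟩
    have hx' : φ x = x := hx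
    rw [LinearMap.map_smulₛₗ, hx', ← sub_smul, hσ, ← ht]
    congr 1; ring

/-- Partial cyclic subspaces modulo the span of the fixed vectors. -/
def cyc (v : V) : ℕ → Submodule k V
  | 0 => Submodule.span k {x | φ x = x}
  | n + 1 => cyc v n ⊔ Submodule.span k {φ^[n] v}

lemma mem_cyc (v : V) (n : ℕ) (x : V) : x ∈ cyc σ φ v n ↔
    ∃ w ∈ Submodule.span k {x | φ x = x}, ∃ c : ℕ → k,
      x = w + ∑ i ∈ Finset.range n, c i • φ^[i] v := by
  induction n generalizing x with
  | zero => simp [cyc]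
  | succ n ih =>
    simp only [cyc, Submodule.mem_sup, Submodule.mem_span_singleton]
    constructor
    · rintro ⟨y, hy, z, ⟨a, rfl⟩, rfl⟩
      obtain ⟨w, hw, c, rfl⟩ := (ih y).1 hy
      refine ⟨w, hw, Function.update c n a, ?_⟩
      rw [Finset.sum_range_succ, add_assoc, Function.update_self]
      congr 2
      apply Finset.sum_congr rfl
      intro i hi
      rw [Function.update_of_ne (Finset.mem_range.1 hi).ne]
    · rintro ⟨w, hw, c, rfl⟩
      exact ⟨_, (ih _).2 ⟨w, hw, c, rfl⟩, _, ⟨c n, rfl⟩, by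
        rw [Finset.sum_range_succ, add_assoc]⟩

theorem lang_span [FiniteDimensional k V] (Q : ℕ) (hQ : 2 ≤ Q) (hσ : ∀ x, σ x = x ^ Q)
    (hφ : Function.Injective φ) : Submodule.span k {x | φ x = x} = ⊤ := by
  have hs : Function.Surjective σ := by
    intro s
    obtain ⟨t, ht⟩ := IsAlgClosed.exists_pow_nat_eq s (n := Q) (by omega)
    exact ⟨t, by rw [hσ, ht]⟩
  rw [Submodule.eq_top_iff']
  by_contra! hcon
  obtain ⟨v, hv⟩ := hcon
  have hex : ∃ n, φ^[n] v ∈ cyc σ φ v n := by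
    have hm : Monotone (cyc σ φ v) := monotone_nat_of_le_succ fun n => le_sup_left
    obtain ⟨n, hn⟩ := monotone_stabilizes_iff_noetherian.2
      (inferInstance : IsNoetherian k V) ⟨cyc σ φ v, hm⟩
    refine ⟨n, ?_⟩
    have : cyc σ φ v n = cyc σ φ v (n + 1) := hn (n + 1) (by omega)
    rw [this]
    exact Submodule.mem_sup_right (Submodule.mem_span_singleton_self _)
  classical
  obtain ⟨m, hm, hmin⟩ : ∃ m, φ^[m] v ∈ cyc σ φ v m ∧ ∀ j < m, φ^[j] v ∉ cyc σ φ v j :=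
    ⟨Nat.find hex, Nat.find_spec hex, fun j hj => Nat.find_min hex hj⟩
  obtain _ | n := m
  · exact hv hm
  obtain ⟨w, hw, c, hc⟩ := (mem_cyc σ φ v _ _).1 hm
  have hnot : ∀ j, φ^[j] v ∉ Submodule.span k {x | φ x = x} := by
    intro j
    induction j with
    | zero => exact hv
    | succ j ih =>
      intro h
      rw [Function.iterate_succ_apply'] at h
      exact ih (lang_pre σ φ hs hφ _ h)
  have hcne : ∃ i ≤ n, c i ≠ 0 := by
    by_contra! h
    apply hnot (n + 1)
    rw [hc, Finset.sum_eq_zero, add_zero]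
    · exact hw
    · intro i hi
      rw [h i (by have := Finset.mem_range.1 hi; omega), zero_smul]
  obtain ⟨t, htn, ht0, ht⟩ := lang_seq Q hQ c n hcne
  set x := ∑ i ∈ Finset.range (n + 1), t i • φ^[i] v with hx
  have hφx : φ x - x = σ (t n) • w := by
    have e1 : φ x = ∑ i ∈ Finset.range n, (t i ^ Q) • φ^[i + 1] v + (t n ^ Q) • φ^[n + 1] v := by
      rw [hx, map_sum, Finset.sum_range_succ]
      simp only [LinearMap.map_smulₛₗ, hσ, Function.iterate_succ_apply']
    rw [e1, hc, hx, Finset.sum_range_succ' (fun i => t i • _),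
      Finset.sum_range_succ' (fun i => c i • _), ht0, hσ]
    simp only [ht, add_smul, Finset.sum_add_distrib, smul_add, Finset.smul_sum, mul_smul]
    abel
  obtain ⟨u, hu, hu'⟩ := lang_solve σ φ Q hQ hσ (φ x - x)
    (hφx ▸ Submodule.smul_mem _ _ hw)
  have hxW : x ∈ Submodule.span k {x | φ x = x} := by
    have : φ (x - u) = x - u := by
      rw [map_sub]
      have : φ u = φ x - x + u := by rw [← hu']; abel
      rw [this]; abel
    have := Submodule.add_mem _ (Submodule.subset_span (R := k) (s := {x | φ x = x}) this) hu
    simpa using this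
  apply hmin n (by omega)
  rw [mem_cyc]
  refine ⟨(t n)⁻¹ • x, Submodule.smul_mem _ _ hxW, fun i => - ((t n)⁻¹ * t i), ?_⟩
  rw [hx, Finset.sum_range_succ, smul_add, smul_smul, inv_mul_cancel₀ htn, one_smul,
    Finset.smul_sum]
  simp only [neg_smul, Finset.sum_neg_distrib, mul_smul]
  abel

end Lang

section Normal
variable {k : Type*} [Field k] [IsAlgClosed k]

/-- The sesquilinear form attached to a matrix. -/
def sesq (σ : k →+* k) (A : Matrix (Fin 4) (Fin 4) k) :
    (Fin 4 → k) →ₛₗ[σ] (Fin 4 → k) →ₗ[k] k :=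
  LinearMap.mk₂'ₛₗ σ (RingHom.id k) (fun x y => (σ ∘ x) ⬝ᵥ (A.mulVec y))
    (by
      intro x y z
      rw [← add_dotProduct]
      congr 1; ext i; simp)
    (by
      intro c x z
      rw [← smul_dotProduct]
      congr 1; ext i; simp)
    (by intro x y z; rw [Matrix.mulVec_add, dotProduct_add])
    (by intro c x y; rw [Matrix.mulVec_smul, dotProduct_smul]; rfl)

lemma sesq_apply (σ : k →+* k) (A : Matrix (Fin 4) (Fin 4) k) (x y : Fin 4 → k) :
    sesq σ A x y = (σ ∘ x) ⬝ᵥ (A.mulVec y) := rfl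

/-- The semilinear map whose fixed vectors are the Hermitian vectors. -/
noncomputable def hermMap (σ : k →+* k) (A : Matrix (Fin 4) (Fin 4) k) :
    (Fin 4 → k) →ₛₗ[σ.comp σ] (Fin 4 → k) where
  toFun x := A⁻¹.mulVec ((A.map σ).transpose.mulVec (σ ∘ σ ∘ x))
  map_add' x y := by
    rw [← Matrix.mulVec_add, ← Matrix.mulVec_add]
    congr 2; ext i; simp
  map_smul' c x := by
    rw [← Matrix.mulVec_smul, ← Matrix.mulVec_smul]
    congr 2; ext i; simp

lemma hermMap_inj (σ : k →+* k) (A : Matrix (Fin 4) (Fin 4) k) (hA : IsUnit A) :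
    Function.Injective (hermMap σ A) := by
  have h1 : IsUnit A⁻¹ := by rwa [Matrix.isUnit_nonsing_inv_iff]
  have h2 : IsUnit (A.map σ).transpose := by
    rw [Matrix.isUnit_transpose]
    exact hA.map (RingHom.mapMatrix σ)
  intro x y hxy
  have := Matrix.mulVec_injective_of_isUnit h2 (Matrix.mulVec_injective_of_isUnit h1 hxy)
  ext i
  exact σ.injective (σ.injective (congrFun this i))

lemma herm_of_fixed (σ : k →+* k) (A : Matrix (Fin 4) (Fin 4) k) (hA : IsUnit A)
    (x : Fin 4 → k) (hx : hermMap σ A x = x) (y : Fin 4 → k) :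
    sesq σ A y x = σ (sesq σ A x y) := by
  have hdet : IsUnit A.det := (Matrix.isUnit_iff_isUnit_det A).1 hA
  have h1 : A.mulVec x = (A.map σ).transpose.mulVec (σ ∘ σ ∘ x) := by
    conv_lhs => rw [← hx]
    show A.mulVec (A⁻¹.mulVec _) = _
    rw [Matrix.mulVec_mulVec, Matrix.mul_nonsing_inv _ hdet, Matrix.one_mulVec]
  rw [sesq_apply, h1, sesq_apply, Matrix.mulVec_transpose, dotProduct_comm,
    ← Matrix.dotProduct_mulVec]
  simp [dotProduct, Matrix.mulVec, map_sum, map_mul]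

lemma fixed_of_herm (σ : k →+* k) (A : Matrix (Fin 4) (Fin 4) k) (hA : IsUnit A)
    (hs : Function.Surjective σ)
    (x : Fin 4 → k) (hx : ∀ y, sesq σ A y x = σ (sesq σ A x y)) : hermMap σ A x = x := by
  have hdet : IsUnit A.det := (Matrix.isUnit_iff_isUnit_det A).1 hA
  have h1 : A.mulVec x = (A.map σ).transpose.mulVec (σ ∘ σ ∘ x) := by
    ext i
    have := hx (Pi.single i 1)
    rw [sesq_apply, sesq_apply] at this
    have e : (σ ∘ (Pi.single i 1 : Fin 4 → k)) = Pi.single i 1 := by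
      ext j; by_cases h : j = i
      · subst h; simp
      · simp [h]
    rw [e, single_one_dotProduct] at this
    rw [this, Matrix.mulVec_single_one]
    simp [dotProduct, Matrix.mulVec, map_sum, map_mul, mul_comm]
  show A⁻¹.mulVec _ = _
  rw [← h1, Matrix.mulVec_mulVec, Matrix.nonsing_inv_mul _ hdet, Matrix.one_mulVec]

lemma gram_step (q : ℕ) (hq : 2 ≤ q) (σ : k →+* k) (hσ : ∀ x, σ x = x ^ q)
    (β : (Fin 4 → k) →ₛₗ[σ] (Fin 4 → k) →ₗ[k] k) (hβ : ∀ x, (∀ y, β x y = 0) → x = 0)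
    (H : Set (Fin 4 → k)) (hH : ∀ x, x ∈ H ↔ ∀ y, β y x = σ (β x y))
    (hspan : Submodule.span k H = ⊤) (j : ℕ) (hj : j < 4) (e : ℕ → Fin 4 → k)
    (heH : ∀ i < j, e i ∈ H) (he : ∀ i < j, ∀ l < j, β (e i) (e l) = if i = l then 1 else 0) :
    ∃ h ∈ H, (∀ i < j, β (e i) h = 0) ∧ (∀ i < j, β h (e i) = 0) ∧ β h h = 1 := by
  classical
  have hadd : ∀ x ∈ H, ∀ y ∈ H, x + y ∈ H := by
    intro x hx y hy
    rw [hH] at *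
    intro z
    simp [hx z, hy z]
  have hsmul : ∀ c : k, σ (σ c) = c → ∀ x ∈ H, c • x ∈ H := by
    intro c hc x hx
    rw [hH] at *
    intro z
    simp [hx z, hc]
  have hval : ∀ x ∈ H, ∀ y ∈ H, σ (σ (β x y)) = β x y := by
    intro x hx y hy
    rw [← (hH x).1 hx y, ← (hH y).1 hy x]
  have hsymm : ∀ x ∈ H, ∀ y, β x y = 0 → β y x = 0 := by
    intro x hx y h
    rw [(hH x).1 hx y, h, map_zero]
  -- the projection
  let P : (Fin 4 → k) → (Fin 4 → k) := fun h => h + ∑ i ∈ Finset.range j, (- β (e i) h) • e i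
  have hsumH : ∀ (c : ℕ → k) (n : ℕ), n ≤ j → (∀ i, σ (σ (c i)) = c i ∨ j ≤ i) →
      ∑ i ∈ Finset.range n, c i • e i ∈ H := by
    intro c n
    induction n with
    | zero =>
      intro _ _
      rw [hH]; simp
    | succ n ih =>
      intro hn hc
      rw [Finset.sum_range_succ]
      refine hadd _ (ih (by omega) hc) _ (hsmul _ ?_ _ (heH n (by omega)))
      rcases hc n with h | h
      · exact h
      · omega
  have hPH : ∀ h ∈ H, P h ∈ H := by
    intro h hh
    refine hadd _ hh _ (hsumH _ j le_rfl ?_)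
    intro i
    rcases Nat.lt_or_ge i j with hi | hi
    · left; rw [map_neg, map_neg, hval _ (heH i hi) _ hh]
    · right; exact hi
  have hP1 : ∀ h, ∀ i < j, β (e i) (P h) = 0 := by
    intro h i hi
    simp only [P, map_add, map_sum, map_smul, smul_eq_mul]
    rw [Finset.sum_eq_single i]
    · rw [he i hi i hi]; simp
    · intro l hl hli
      rw [he i hi l (Finset.mem_range.1 hl), if_neg hli.symm, mul_zero]
    · intro h; exact absurd (Finset.mem_range.2 hi) h
  by_cases hall : ∀ x ∈ H, ∀ y ∈ H, β (P x) (P y) = 0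
  · exfalso
    have hz : ∀ x ∈ H, P x = 0 := by
      intro x hx
      apply hβ
      have : ∀ y ∈ H, β (P x) y = 0 := by
        intro y hy
        have h1 := hall x hx y hy
        have h2 : β (P x) (P y) = β (P x) y := by
          conv_lhs => rw [show P y = y + ∑ i ∈ Finset.range j, (- β (e i) y) • e i from rfl]
          rw [map_add, map_sum, Finset.sum_eq_zero, add_zero]
          intro i hi
          have hi' := Finset.mem_range.1 hi
          rw [map_smul, hsymm _ (heH i hi') _ (hP1 x i hi'), smul_zero]
        rw [← h2, h1]
      intro y
      have hy : y ∈ Submodule.span k H := by rw [hspan]; trivial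
      have hle : Submodule.span k H ≤ LinearMap.ker (β (P x)) := Submodule.span_le.2 this
      exact hle hy
    have hle : (⊤ : Submodule k (Fin 4 → k)) ≤
        Submodule.span k (((Finset.range j).image e : Finset (Fin 4 → k)) : Set (Fin 4 → k)) := by
      rw [← hspan, Submodule.span_le]
      intro x hx
      have : x = - ∑ i ∈ Finset.range j, (- β (e i) x) • e i :=
        eq_neg_of_add_eq_zero_left (hz x hx)
      rw [this]
      refine Submodule.neg_mem _ (Submodule.sum_mem _ fun i hi => Submodule.smul_mem _ _
        (Submodule.subset_span ?_))
      exact Finset.mem_coe.2 (Finset.mem_image_of_mem _ hi)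
    have h1 := Submodule.finrank_mono hle
    have h2 := finrank_span_finset_le_card (R := k) ((Finset.range j).image e)
    have h3 : ((Finset.range j).image e).card ≤ j := by
      simpa using Finset.card_image_le (s := Finset.range j) (f := e)
    rw [finrank_top, Module.finrank_fin_fun] at h1
    unfold Set.finrank at h2
    omega
  · -- it suffices to find a non-isotropic vector
    suffices hsuff : ∃ h ∈ H, (∀ i < j, β (e i) h = 0) ∧ β h h ≠ 0 by
      obtain ⟨h, hh, h1, h2⟩ := hsuff
      obtain ⟨t, ht⟩ := IsAlgClosed.exists_pow_nat_eq (β h h)⁻¹ (n := q + 1) (by omega)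
      have ht0 : t ≠ 0 := by
        rintro rfl
        rw [zero_pow (by omega)] at ht
        exact inv_ne_zero h2 ht.symm
      have hcc : σ (β h h) = β h h := ((hH h).1 hh h).symm
      have htt : σ t * t = (β h h)⁻¹ := by rw [hσ, ← ht, pow_succ]
      have htF : σ (σ t) = t := by
        have e1 : σ (σ t) * σ t = (β h h)⁻¹ := by rw [← map_mul, htt, map_inv₀, hcc]
        have e2 : σ t ≠ 0 := by rwa [ne_eq, map_eq_zero]
        apply mul_right_cancel₀ e2
        rw [e1, ← htt, mul_comm]
      refine ⟨t • h, hsmul t htF h hh, ?_, ?_, ?_⟩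
      · intro i hi; rw [map_smul, h1 i hi, smul_zero]
      · intro i hi
        apply hsymm _ (heH i hi)
        rw [map_smul, h1 i hi, smul_zero]
      · rw [LinearMap.map_smulₛₗ β, LinearMap.smul_apply, map_smul, smul_eq_mul, smul_eq_mul,
          ← mul_assoc, htt, inv_mul_cancel₀ h2]
    push Not at hall
    obtain ⟨x, hx, y, hy, hxy⟩ := hall
    by_cases hxx : β (P x) (P x) = 0
    · by_cases hyy : β (P y) (P y) = 0
      · obtain ⟨μ, hμ⟩ := exists_pow_sub q hq (1 : k) 1
        have hμ1 : σ μ = 1 - μ := by rw [hσ, ← hμ]; ring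
        have hμ2 : σ (σ μ) = μ := by rw [hμ1, map_sub, map_one, hμ1]; ring
        set b := β (P x) (P y) with hb
        have hbb : σ (σ b) = b := hval _ (hPH x hx) _ (hPH y hy)
        have hyx : β (P y) (P x) = σ b := (hH _).1 (hPH x hx) (P y)
        have hl : σ (σ (μ * b⁻¹)) = μ * b⁻¹ := by
          rw [map_mul, map_mul, hμ2, map_inv₀, map_inv₀, hbb]
        refine ⟨P x + (μ * b⁻¹) • P y, hadd _ (hPH x hx) _ (hsmul _ hl _ (hPH y hy)), ?_, ?_⟩
        · intro i hi
          rw [map_add, map_smul, hP1 x i hi, hP1 y i hi]; simp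
        · have hb' : σ b ≠ 0 := by rwa [ne_eq, map_eq_zero]
          have : β (P x + (μ * b⁻¹) • P y) (P x + (μ * b⁻¹) • P y) = 1 := by
            simp only [map_add, LinearMap.add_apply, map_smul, LinearMap.map_smulₛₗ,
              LinearMap.smul_apply, smul_eq_mul, hxx, hyy, hyx, ← hb, map_mul, map_inv₀, hμ1]
            field_simp
            ring
          rw [this]; exact one_ne_zero
      · exact ⟨P y, hPH y hy, hP1 y, hyy⟩
    · exact ⟨P x, hPH x hx, hP1 x, hxx⟩

theorem exists_orthonormal (q : ℕ) (hq : 2 ≤ q) (σ : k →+* k) (hσ : ∀ x, σ x = x ^ q)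
    (A : Matrix (Fin 4) (Fin 4) k) (hA : IsUnit A) :
    ∃ e : Fin 4 → Fin 4 → k, ∀ i l, sesq σ A (e i) (e l) = if i = l then 1 else 0 := by
  have hs : Function.Surjective σ := by
    intro s
    obtain ⟨t, ht⟩ := IsAlgClosed.exists_pow_nat_eq s (n := q) (by omega)
    exact ⟨t, by rw [hσ, ht]⟩
  have hspan := lang_span (σ.comp σ) (hermMap σ A) (q * q) (by nlinarith)
    (fun x => by rw [RingHom.comp_apply, hσ, hσ, pow_mul]) (hermMap_inj σ A hA)
  have hH : ∀ x, x ∈ {x | hermMap σ A x = x} ↔ ∀ y, sesq σ A y x = σ (sesq σ A x y) := fun x =>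
    ⟨fun h => herm_of_fixed σ A hA x h, fun h => fixed_of_herm σ A hA hs x h⟩
  have hβ : ∀ x, (∀ y, sesq σ A x y = 0) → x = 0 := by
    intro x hx
    have hdet : IsUnit A.det := (Matrix.isUnit_iff_isUnit_det A).1 hA
    ext i
    have := hx (A⁻¹.mulVec (Pi.single i 1))
    rw [sesq_apply, Matrix.mulVec_mulVec, Matrix.mul_nonsing_inv _ hdet, Matrix.one_mulVec,
      dotProduct_single_one] at this
    simpa using this
  have main : ∀ j ≤ 4, ∃ e : ℕ → Fin 4 → k, (∀ i < j, e i ∈ {x | hermMap σ A x = x}) ∧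
      ∀ i < j, ∀ l < j, sesq σ A (e i) (e l) = if i = l then 1 else 0 := by
    intro j
    induction j with
    | zero => intro _; exact ⟨fun _ => 0, by simp, by simp⟩
    | succ j ih =>
      intro hj
      obtain ⟨e, he1, he2⟩ := ih (by omega)
      obtain ⟨h, hh, h1, h2, h3⟩ := gram_step q hq σ hσ (sesq σ A) hβ _ hH hspan j (by omega)
        e he1 he2
      refine ⟨Function.update e j h, ?_, ?_⟩
      · intro i hi
        by_cases hij : i = j
        · subst hij; simpa using hh
        · rw [Function.update_of_ne hij]; exact he1 i (by omega)
      · intro i hi l hl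
        by_cases hij : i = j
        · subst hij
          by_cases hlj : l = i
          · subst hlj; simpa using h3
          · rw [Function.update_self, Function.update_of_ne hlj, if_neg (Ne.symm hlj)]
            exact h2 l (by omega)
        · by_cases hlj : l = j
          · subst hlj
            rw [Function.update_self, Function.update_of_ne hij, if_neg hij]
            exact h1 i (by omega)
          · rw [Function.update_of_ne hij, Function.update_of_ne hlj]
            exact he2 i (by omega) l (by omega)
  obtain ⟨e, -, he⟩ := main 4 le_rfl
  refine ⟨fun i => e i, fun i l => ?_⟩
  rw [he i i.2 l l.2]
  simp [Fin.ext_iff]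

theorem exists_fermat_equiv (q : ℕ) (hq : 2 ≤ q) (σ : k →+* k) (hσ : ∀ x, σ x = x ^ q)
    (A : Matrix (Fin 4) (Fin 4) k) (hA : IsUnit A) :
    ∃ g : (Fin 4 → k) ≃ₗ[k] (Fin 4 → k), ∀ x, frobForm q A (g x) = ∑ i, x i ^ (q + 1) := by
  obtain ⟨e, he⟩ := exists_orthonormal q hq σ hσ A hA
  have hcoef : ∀ (x : Fin 4 → k) i, sesq σ A (e i) (∑ j, x j • e j) = x i := by
    intro x i
    simp [map_sum, he]
  have hli : LinearIndependent k e := by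
    rw [Fintype.linearIndependent_iff]
    intro x hx i
    rw [← hcoef x i, hx, map_zero]
  let b := basisOfLinearIndependentOfCardEqFinrank hli (by simp)
  refine ⟨b.equivFun.symm, fun x => ?_⟩
  have hx : b.equivFun.symm x = ∑ j, x j • e j := by
    rw [Basis.equivFun_symm_apply]; simp [b]
  have hf : ∀ y, frobForm q A y = sesq σ A y y := by
    intro y
    rw [sesq_apply, frobForm]
    simp only [dotProduct, Matrix.mulVec, Finset.mul_sum, Function.comp, hσ]
    exact Finset.sum_congr rfl fun i _ => Finset.sum_congr rfl fun j _ => by ring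
  rw [hf, hx]
  conv_lhs => rw [map_sum (sesq σ A)]
  rw [LinearMap.sum_apply]
  refine Finset.sum_congr rfl fun i _ => ?_
  rw [LinearMap.map_smulₛₗ, LinearMap.smul_apply, hcoef, hσ, smul_eq_mul, pow_succ]

end Normal


section Fermat
variable {k : Type*} [Field k]

/-- The line `x0 = a x1, x2 = b x3`. -/
def lineP (a b : k) : Submodule k (Fin 4 → k) where
  carrier := {x | x 0 = a * x 1 ∧ x 2 = b * x 3}
  zero_mem' := by simp
  add_mem' := by
    rintro x y ⟨h1, h2⟩ ⟨h3, h4⟩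
    exact ⟨by simp only [Pi.add_apply, h1, h3]; ring, by simp only [Pi.add_apply, h2, h4]; ring⟩
  smul_mem' := by
    rintro c x ⟨h1, h2⟩
    exact ⟨by simp only [Pi.smul_apply, smul_eq_mul, h1]; ring,
      by simp only [Pi.smul_apply, smul_eq_mul, h2]; ring⟩

/-- The line `x0 = a x2, x1 = b x3`. -/
def lineN (a b : k) : Submodule k (Fin 4 → k) where
  carrier := {x | x 0 = a * x 2 ∧ x 1 = b * x 3}
  zero_mem' := by simp
  add_mem' := by
    rintro x y ⟨h1, h2⟩ ⟨h3, h4⟩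
    exact ⟨by simp only [Pi.add_apply, h1, h3]; ring, by simp only [Pi.add_apply, h2, h4]; ring⟩
  smul_mem' := by
    rintro c x ⟨h1, h2⟩
    exact ⟨by simp only [Pi.smul_apply, smul_eq_mul, h1]; ring,
      by simp only [Pi.smul_apply, smul_eq_mul, h2]; ring⟩

lemma mem_lineP {a b : k} {x : Fin 4 → k} : x ∈ lineP a b ↔ x 0 = a * x 1 ∧ x 2 = b * x 3 :=
  Iff.rfl

lemma mem_lineN {a b : k} {x : Fin 4 → k} : x ∈ lineN a b ↔ x 0 = a * x 2 ∧ x 1 = b * x 3 :=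
  Iff.rfl

/-- A parametrization of `lineP`. -/
def equivP (a b : k) : lineP a b ≃ₗ[k] (Fin 2 → k) where
  toFun x := ![x.1 1, x.1 3]
  map_add' x y := by ext i; fin_cases i <;> simp
  map_smul' c x := by ext i; fin_cases i <;> simp
  invFun y := ⟨![a * y 0, y 0, b * y 1, y 1], by simp [mem_lineP]⟩
  left_inv := by
    rintro ⟨x, h1, h2⟩
    ext i; fin_cases i <;> simp [h1, h2]
  right_inv y := by ext i; fin_cases i <;> simp

/-- A parametrization of `lineN`. -/
def equivN (a b : k) : lineN a b ≃ₗ[k] (Fin 2 → k) where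
  toFun x := ![x.1 2, x.1 3]
  map_add' x y := by ext i; fin_cases i <;> simp
  map_smul' c x := by ext i; fin_cases i <;> simp
  invFun y := ⟨![a * y 0, b * y 1, y 0, y 1], by simp [mem_lineN]⟩
  left_inv := by
    rintro ⟨x, h1, h2⟩
    ext i; fin_cases i <;> simp [h1, h2]
  right_inv y := by ext i; fin_cases i <;> simp

lemma isLine_P (a b : k) : IsLine (lineP a b) := by
  rw [IsLine, (equivP a b).finrank_eq]; simp

lemma isLine_N (a b : k) : IsLine (lineN a b) := by
  rw [IsLine, (equivN a b).finrank_eq]; simp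

lemma skew_PP {a b a' b' : k} : lineP a b ⊓ lineP a' b' = ⊥ ↔ a ≠ a' ∧ b ≠ b' := by
  constructor
  · intro h
    constructor
    · rintro rfl
      have : (![a, 1, 0, 0] : Fin 4 → k) ∈ lineP a b ⊓ lineP a b' := by
        simp [Submodule.mem_inf, mem_lineP]
      rw [h, Submodule.mem_bot] at this
      simpa using congrFun this 1
    · rintro rfl
      have : (![0, 0, b, 1] : Fin 4 → k) ∈ lineP a b ⊓ lineP a' b := by
        simp [Submodule.mem_inf, mem_lineP]
      rw [h, Submodule.mem_bot] at this
      simpa using congrFun this 3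
  · rintro ⟨h1, h2⟩
    rw [Submodule.eq_bot_iff]
    rintro x ⟨⟨h3, h4⟩, ⟨h5, h6⟩⟩
    have e1 : x 1 = 0 := by
      have : (a - a') * x 1 = 0 := by linear_combination h5 - h3
      exact (mul_eq_zero.1 this).resolve_left (sub_ne_zero.2 h1)
    have e3 : x 3 = 0 := by
      have : (b - b') * x 3 = 0 := by linear_combination h6 - h4
      exact (mul_eq_zero.1 this).resolve_left (sub_ne_zero.2 h2)
    ext i; fin_cases i <;> simp [e1, e3, h3, h4]

lemma skew_NN {a b a' b' : k} : lineN a b ⊓ lineN a' b' = ⊥ ↔ a ≠ a' ∧ b ≠ b' := by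
  constructor
  · intro h
    constructor
    · rintro rfl
      have : (![a, 0, 1, 0] : Fin 4 → k) ∈ lineN a b ⊓ lineN a b' := by
        simp [Submodule.mem_inf, mem_lineN]
      rw [h, Submodule.mem_bot] at this
      simpa using congrFun this 2
    · rintro rfl
      have : (![0, b, 0, 1] : Fin 4 → k) ∈ lineN a b ⊓ lineN a' b := by
        simp [Submodule.mem_inf, mem_lineN]
      rw [h, Submodule.mem_bot] at this
      simpa using congrFun this 3
  · rintro ⟨h1, h2⟩
    rw [Submodule.eq_bot_iff]
    rintro x ⟨⟨h3, h4⟩, ⟨h5, h6⟩⟩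
    have e1 : x 2 = 0 := by
      have : (a - a') * x 2 = 0 := by linear_combination h5 - h3
      exact (mul_eq_zero.1 this).resolve_left (sub_ne_zero.2 h1)
    have e3 : x 3 = 0 := by
      have : (b - b') * x 3 = 0 := by linear_combination h6 - h4
      exact (mul_eq_zero.1 this).resolve_left (sub_ne_zero.2 h2)
    ext i; fin_cases i <;> simp [e1, e3, h3, h4]

lemma skew_PN {a b a' b' : k} : lineP a b ⊓ lineN a' b' = ⊥ ↔ a * b' ≠ a' * b := by
  constructor
  · intro h h'
    have : (![a * b', b', b, 1] : Fin 4 → k) ∈ lineP a b ⊓ lineN a' b' := by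
      simp [Submodule.mem_inf, mem_lineP, mem_lineN, h']
    rw [h, Submodule.mem_bot] at this
    simpa using congrFun this 3
  · intro h
    rw [Submodule.eq_bot_iff]
    rintro x ⟨⟨h3, h4⟩, ⟨h5, h6⟩⟩
    have e3 : x 3 = 0 := by
      have : (a * b' - a' * b) * x 3 = 0 := by
        linear_combination h5 - h3 + a' * h4 - a * h6
      exact (mul_eq_zero.1 this).resolve_left (sub_ne_zero.2 h)
    have e1 : x 1 = 0 := by rw [h6, e3, mul_zero]
    have e2 : x 2 = 0 := by rw [h4, e3, mul_zero]
    ext i; fin_cases i <;> simp [e1, e2, e3, h3]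

lemma skew_NP {a b a' b' : k} : lineN a b ⊓ lineP a' b' = ⊥ ↔ a' * b ≠ a * b' := by
  rw [inf_comm, skew_PN]

lemma P_inj {a b a' b' : k} : lineP a b = lineP a' b' ↔ a = a' ∧ b = b' := by
  constructor
  · intro h
    have : (![a, 1, b, 1] : Fin 4 → k) ∈ lineP a b := by simp [mem_lineP]
    rw [h] at this
    simpa [mem_lineP] using this
  · rintro ⟨rfl, rfl⟩; rfl

lemma N_inj {a b a' b' : k} : lineN a b = lineN a' b' ↔ a = a' ∧ b = b' := by
  constructor
  · intro h
    have : (![a, b, 1, 1] : Fin 4 → k) ∈ lineN a b := by simp [mem_lineN]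
    rw [h] at this
    simpa [mem_lineN] using this
  · rintro ⟨rfl, rfl⟩; rfl

lemma P_ne_N {a b a' b' : k} : lineP a b ≠ lineN a' b' := by
  intro h
  have : (![a, 1, 0, 0] : Fin 4 → k) ∈ lineP a b := by simp [mem_lineP]
  rw [h] at this
  simp [mem_lineN] at this

/-- The Fermat cone. -/
def fermatCone (k : Type*) [Field k] (q : ℕ) : Set (Fin 4 → k) := {x | ∑ i, x i ^ (q + 1) = 0}

lemma P_sub {q : ℕ} {a b : k} (ha : a ^ (q + 1) = -1) (hb : b ^ (q + 1) = -1) :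
    (lineP a b : Set (Fin 4 → k)) ⊆ fermatCone k q := by
  rintro x ⟨h1, h2⟩
  simp only [fermatCone, Set.mem_ofPred_eq, Fin.sum_univ_four, h1, h2, mul_pow, ha, hb]
  ring

lemma N_sub {q : ℕ} {a b : k} (ha : a ^ (q + 1) = -1) (hb : b ^ (q + 1) = -1) :
    (lineN a b : Set (Fin 4 → k)) ⊆ fermatCone k q := by
  rintro x ⟨h1, h2⟩
  simp only [fermatCone, Set.mem_ofPred_eq, Fin.sum_univ_four, h1, h2, mul_pow, ha, hb]
  ring

lemma ncard_aux {α : Type*} {q : ℕ} {S : Set k} (hS : S.ncard = q + 1) {f : k → α}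
    (hf : Function.Injective f) {x y : α} (hxy : x ≠ y) (hx : ∀ a, f a ≠ x) (hy : ∀ a, f a ≠ y) :
    (f '' S ∪ {x, y}).ncard = q + 1 + 2 := by
  have hfin : S.Finite := Set.finite_of_ncard_ne_zero (by omega)
  have : Finite (f '' S) := hfin.image _
  rw [Set.ncard_union_eq, Set.ncard_image_of_injective _ hf, hS, Set.ncard_pair hxy]
  · rw [Set.disjoint_left]
    rintro _ ⟨a, _, rfl⟩ (h | h)
    · exact hx _ h
    · exact hy _ h

lemma ncard_aux2 {α : Type*} {q : ℕ} {S : Set k} (hS : S.ncard = q + 1) {f g : k → α}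
    (hf : Function.Injective f) (hg : Function.Injective g) (hfg : ∀ a b, f a ≠ g b) :
    (f '' S ∪ g '' S).ncard = 2 * (q + 1) := by
  have hfin : S.Finite := Set.finite_of_ncard_ne_zero (by omega)
  have : Finite (f '' S) := hfin.image _
  have : Finite (g '' S) := hfin.image _
  rw [Set.ncard_union_eq, Set.ncard_image_of_injective _ hf, Set.ncard_image_of_injective _ hg, hS]
  · ring
  · rw [Set.disjoint_left]
    rintro _ ⟨a, _, rfl⟩ ⟨b, _, h⟩
    exact hfg _ _ h.symm

lemma roots_exist [IsAlgClosed k] (n : ℕ) (hn : 2 ≤ n) (h0 : (n : k) ≠ 0) :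
    {a : k | a ^ n = -1}.ncard = n ∧ ∃ c : k, c ≠ 1 ∧ c ^ n = 1 := by
  have : NeZero (n : k) := ⟨h0⟩
  obtain ⟨ζ, hζ⟩ := HasEnoughRootsOfUnity.exists_primitiveRoot k n
  refine ⟨?_, ζ, hζ.ne_one (by omega), hζ.pow_eq_one⟩
  classical
  have hset : {a : k | a ^ n = -1} = ((Polynomial.nthRoots n (-1 : k)).toFinset : Set k) := by
    ext a
    simp [Polynomial.mem_nthRoots (show 0 < n by omega)]
  rw [hset, Set.ncard_coe_finset, Multiset.toFinset_card_of_nodup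
    (hζ.nthRoots_nodup (by simp)), hζ.card_nthRoots,
    if_pos (IsAlgClosed.exists_pow_nat_eq _ (by omega))]

theorem fermat_double [IsAlgClosed k] (q : ℕ) (hq : 1 ≤ q) (h0 : ((q + 1 : ℕ) : k) ≠ 0) :
    ∃ 𝒜 ℬ : Set (Submodule k (Fin 4 → k)),
      (∀ L ∈ 𝒜, IsLineOn (fermatCone k q) L) ∧
      (∀ L ∈ ℬ, IsLineOn (fermatCone k q) L) ∧
      IsDoubleTwoD (q + 1) 𝒜 ℬ := by
  obtain ⟨hS, c, hc1, hc⟩ := roots_exist (k := k) (q + 1) (by omega) h0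
  have hc0 : c ≠ 0 := by rintro rfl; simp at hc
  set S : Set k := {a : k | a ^ (q + 1) = -1} with hSdef
  have hSc : ∀ a ∈ S, c * a ∈ S := by
    intro a ha
    have ha' : a ^ (q + 1) = -1 := ha
    show (c * a) ^ (q + 1) = -1
    rw [mul_pow, hc, ha', one_mul]
  have hSd : ∀ a ∈ S, c⁻¹ * a ∈ S := by
    intro a ha
    have ha' : a ^ (q + 1) = -1 := ha
    show (c⁻¹ * a) ^ (q + 1) = -1
    rw [mul_pow, inv_pow, hc, ha', inv_one, one_mul]
  have hS0 : ∀ a ∈ S, a ≠ 0 := by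
    rintro a ha rfl
    have ha' : (0 : k) ^ (q + 1) = -1 := ha
    simp at ha'
  have hca : ∀ a ∈ S, c * a ≠ a := by
    intro a ha h
    exact hc1 (mul_right_cancel₀ (hS0 a ha) (by rw [h, one_mul]))
  have i1 : Function.Injective (fun a : k => lineP a a) := fun a b h => (P_inj.1 h).1
  have i2 : Function.Injective (fun a : k => lineP a (c * a)) := fun a b h => (P_inj.1 h).1
  have i3 : Function.Injective (fun a : k => lineN a a) := fun a b h => (N_inj.1 h).1
  have i4 : Function.Injective (fun a : k => lineN a (c * a)) := fun a b h => (N_inj.1 h).1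
  have hcc : ∀ a : k, c * (c⁻¹ * a) = a := fun a => by rw [← mul_assoc, mul_inv_cancel₀ hc0, one_mul]
  refine ⟨(fun a => lineP a a) '' S ∪ (fun a => lineN a (c * a)) '' S,
    (fun a => lineN a a) '' S ∪ (fun a => lineP a (c * a)) '' S, ?_, ?_,
    ncard_aux2 hS i1 i4 (fun a b => P_ne_N), ncard_aux2 hS i3 i2 (fun a b => P_ne_N.symm),
    ?_, ?_, ?_, ?_, ?_, ?_⟩
  · rintro _ (⟨a, ha, rfl⟩ | ⟨a, ha, rfl⟩)
    · exact ⟨isLine_P _ _, P_sub ha ha⟩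
    · exact ⟨isLine_N _ _, N_sub ha (hSc a ha)⟩
  · rintro _ (⟨a, ha, rfl⟩ | ⟨a, ha, rfl⟩)
    · exact ⟨isLine_N _ _, N_sub ha ha⟩
    · exact ⟨isLine_P _ _, P_sub ha (hSc a ha)⟩
  · rintro _ (⟨a, ha, rfl⟩ | ⟨a, ha, rfl⟩)
    · exact isLine_P _ _
    · exact isLine_N _ _
  · rintro _ (⟨a, ha, rfl⟩ | ⟨a, ha, rfl⟩)
    · exact isLine_N _ _
    · exact isLine_P _ _
  · have key : ∀ a ∈ S, ∀ b ∈ S, a * (c * b) ≠ b * a := by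
      intro a ha b hb h
      apply hca b hb
      apply mul_left_cancel₀ (hS0 a ha)
      rw [h, mul_comm]
    rintro _ (⟨a, ha, rfl⟩ | ⟨a, ha, rfl⟩) _ (⟨b, hb, rfl⟩ | ⟨b, hb, rfl⟩) hne
    · have : a ≠ b := by rintro rfl; exact hne rfl
      exact skew_PP.2 ⟨this, this⟩
    · exact skew_PN.2 (key a ha b hb)
    · exact skew_NP.2 (key b hb a ha)
    · have : a ≠ b := by rintro rfl; exact hne rfl
      exact skew_NN.2 ⟨this, fun h => this (mul_left_cancel₀ hc0 h)⟩
  · have key : ∀ a ∈ S, ∀ b ∈ S, b * a ≠ a * (c * b) := by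
      intro a ha b hb h
      apply hca b hb
      apply mul_left_cancel₀ (hS0 a ha)
      rw [← h, mul_comm]
    rintro _ (⟨a, ha, rfl⟩ | ⟨a, ha, rfl⟩) _ (⟨b, hb, rfl⟩ | ⟨b, hb, rfl⟩) hne
    · have : a ≠ b := by rintro rfl; exact hne rfl
      exact skew_NN.2 ⟨this, this⟩
    · exact skew_NP.2 (key a ha b hb)
    · exact skew_PN.2 (key b hb a ha)
    · have : a ≠ b := by rintro rfl; exact hne rfl
      exact skew_PP.2 ⟨this, fun h => this (mul_left_cancel₀ hc0 h)⟩
  · rintro _ (⟨a, ha, rfl⟩ | ⟨a, ha, rfl⟩)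
    · rw [← ncard_aux hS i3 (x := lineP a (c * a)) (y := lineP (c⁻¹ * a) a)
        (fun h => hca a ha (P_inj.1 h).2) (fun _ => P_ne_N.symm) (fun _ => P_ne_N.symm)]
      congr 1
      ext M
      constructor
      · rintro ⟨⟨b, hb, rfl⟩ | ⟨b, hb, rfl⟩, hM⟩
        · exact Or.inl ⟨b, hb, rfl⟩
        · right
          simp only [MeetsLine, ne_eq, skew_PP] at hM
          by_cases hab : a = b
          · left; rw [hab]
          · right
            have : a = c * b := by tauto
            simp [this, ← mul_assoc, inv_mul_cancel₀ hc0]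
      · rintro (⟨b, hb, rfl⟩ | rfl | rfl)
        · refine ⟨Or.inl ⟨b, hb, rfl⟩, fun h => skew_PN.1 h (mul_comm _ _)⟩
        · exact ⟨Or.inr ⟨a, ha, rfl⟩, fun h => (skew_PP.1 h).1 rfl⟩
        · exact ⟨Or.inr ⟨c⁻¹ * a, hSd a ha, by simp only [hcc]⟩, fun h => (skew_PP.1 h).2 rfl⟩
    · rw [← ncard_aux hS i2 (x := lineN a a) (y := lineN (c * a) (c * a))
        (fun h => hca a ha (N_inj.1 h).2.symm) (fun _ => P_ne_N) (fun _ => P_ne_N)]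
      congr 1
      ext M
      constructor
      · rintro ⟨⟨b, hb, rfl⟩ | ⟨b, hb, rfl⟩, hM⟩
        · right
          simp only [MeetsLine, ne_eq, skew_NN] at hM
          by_cases hab : a = b
          · left; rw [hab]
          · right
            have : c * a = b := by tauto
            rw [this]; rfl
        · exact Or.inl ⟨b, hb, rfl⟩
      · rintro (⟨b, hb, rfl⟩ | rfl | rfl)
        · refine ⟨Or.inr ⟨b, hb, rfl⟩, fun h => skew_NP.1 h (by ring)⟩
        · exact ⟨Or.inl ⟨a, ha, rfl⟩, fun h => (skew_NN.1 h).1 rfl⟩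
        · exact ⟨Or.inl ⟨c * a, hSc a ha, rfl⟩, fun h => (skew_NN.1 h).2 rfl⟩
  · rintro _ (⟨a, ha, rfl⟩ | ⟨a, ha, rfl⟩)
    · rw [← ncard_aux hS i1 (x := lineN a (c * a)) (y := lineN (c⁻¹ * a) a)
        (fun h => hca a ha (N_inj.1 h).2) (fun _ => P_ne_N) (fun _ => P_ne_N)]
      congr 1
      ext M
      constructor
      · rintro ⟨⟨b, hb, rfl⟩ | ⟨b, hb, rfl⟩, hM⟩
        · exact Or.inl ⟨b, hb, rfl⟩
        · right
          simp only [MeetsLine, ne_eq, skew_NN] at hM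
          by_cases hab : a = b
          · left; rw [hab]
          · right
            have : c * b = a := by tauto
            simp [← this, ← mul_assoc, inv_mul_cancel₀ hc0]
      · rintro (⟨b, hb, rfl⟩ | rfl | rfl)
        · refine ⟨Or.inl ⟨b, hb, rfl⟩, fun h => skew_PN.1 h (mul_comm _ _)⟩
        · exact ⟨Or.inr ⟨a, ha, rfl⟩, fun h => (skew_NN.1 h).1 rfl⟩
        · exact ⟨Or.inr ⟨c⁻¹ * a, hSd a ha, by simp only [hcc]⟩, fun h => (skew_NN.1 h).2 rfl⟩
    · rw [← ncard_aux hS i4 (x := lineP a a) (y := lineP (c * a) (c * a))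
        (fun h => hca a ha (P_inj.1 h).2.symm) (fun _ => P_ne_N.symm) (fun _ => P_ne_N.symm)]
      congr 1
      ext M
      constructor
      · rintro ⟨⟨b, hb, rfl⟩ | ⟨b, hb, rfl⟩, hM⟩
        · right
          simp only [MeetsLine, ne_eq, skew_PP] at hM
          by_cases hab : b = a
          · left; rw [hab]
          · right
            have : b = c * a := by tauto
            rw [this]; rfl
        · exact Or.inl ⟨b, hb, rfl⟩
      · rintro (⟨b, hb, rfl⟩ | rfl | rfl)
        · refine ⟨Or.inr ⟨b, hb, rfl⟩, fun h => skew_NP.1 h (by ring)⟩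
        · exact ⟨Or.inl ⟨a, ha, rfl⟩, fun h => (skew_PP.1 h).1 rfl⟩
        · exact ⟨Or.inl ⟨c * a, hSc a ha, rfl⟩, fun h => (skew_PP.1 h).2 rfl⟩

/-- Transport of a double `2d` under a linear automorphism. -/
lemma double_map (g : (Fin 4 → k) ≃ₗ[k] (Fin 4 → k)) (d : ℕ)
    (𝒜 ℬ : Set (Submodule k (Fin 4 → k))) (h : IsDoubleTwoD d 𝒜 ℬ) :
    IsDoubleTwoD d (Submodule.map g.toLinearMap '' 𝒜) (Submodule.map g.toLinearMap '' ℬ) := by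
  have hinj : Function.Injective (Submodule.map g.toLinearMap) :=
    Submodule.map_injective_of_injective g.injective
  have hline : ∀ L, IsLine L → IsLine (Submodule.map g.toLinearMap L) := by
    intro L hL
    rw [IsLine, LinearEquiv.finrank_map_eq]; exact hL
  have hskew : ∀ L M, Submodule.map g.toLinearMap L ⊓ Submodule.map g.toLinearMap M = ⊥ ↔
      L ⊓ M = ⊥ := by
    intro L M
    rw [← Submodule.map_inf _ g.injective]
    constructor
    · intro h
      apply hinj
      rw [h, Submodule.map_bot]
    · intro h
      rw [h, Submodule.map_bot]
  obtain ⟨h1, h2, h3, h4, h5, h6, h7, h8⟩ := h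
  refine ⟨by rw [Set.ncard_image_of_injective _ hinj, h1],
    by rw [Set.ncard_image_of_injective _ hinj, h2], ?_, ?_, ?_, ?_, ?_, ?_⟩
  · rintro _ ⟨L, hL, rfl⟩
    exact hline _ (h3 L hL)
  · rintro _ ⟨L, hL, rfl⟩
    exact hline _ (h4 L hL)
  · rintro _ ⟨L, hL, rfl⟩ _ ⟨M, hM, rfl⟩ hne
    exact (hskew _ _).2 (h5 L hL M hM (fun h => hne (by rw [h])))
  · rintro _ ⟨L, hL, rfl⟩ _ ⟨M, hM, rfl⟩ hne
    exact (hskew _ _).2 (h6 L hL M hM (fun h => hne (by rw [h])))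
  · rintro _ ⟨L, hL, rfl⟩
    rw [← h7 L hL]
    refine Eq.trans ?_ (Set.ncard_image_of_injective _ hinj)
    congr 1
    ext M
    constructor
    · rintro ⟨⟨N, hN, rfl⟩, hM⟩
      exact ⟨N, ⟨hN, fun h => hM ((hskew _ _).2 h)⟩, rfl⟩
    · rintro ⟨N, ⟨hN, hM⟩, rfl⟩
      exact ⟨⟨N, hN, rfl⟩, fun h => hM ((hskew _ _).1 h)⟩
  · rintro _ ⟨L, hL, rfl⟩
    rw [← h8 L hL]
    refine Eq.trans ?_ (Set.ncard_image_of_injective _ hinj)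
    congr 1
    ext M
    constructor
    · rintro ⟨⟨N, hN, rfl⟩, hM⟩
      exact ⟨N, ⟨hN, fun h => hM ((hskew _ _).2 h)⟩, rfl⟩
    · rintro ⟨N, ⟨hN, hM⟩, rfl⟩
      exact ⟨⟨N, hN, rfl⟩, fun h => hM ((hskew _ _).1 h)⟩

end Fermat
/-- Every smooth extremal surface `X` of degree `d = q+1`
in ℙ³(k) contains a double `2d`: there are sets `𝒜`, `ℬ`, each consisting of
`2d` lines on `X`, forming a double `2d`. -/
theorem exists_double_2d {k : Type*} [Field k] [IsAlgClosed k]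
    (p e q : ℕ) (hp : p.Prime) (hchar : CharP k p) (he : 1 ≤ e) (hq : q = p ^ e)
    (A : Matrix (Fin 4) (Fin 4) k) (hA : IsUnit A) :
    ∃ 𝒜 ℬ : Set (Submodule k (Fin 4 → k)),
      (∀ L ∈ 𝒜, IsLineOn (extremalCone k q A) L) ∧
      (∀ L ∈ ℬ, IsLineOn (extremalCone k q A) L) ∧
      IsDoubleTwoD (q + 1) 𝒜 ℬ := by
  have : Fact p.Prime := ⟨hp⟩
  have := hchar
  have : ExpChar k p := ExpChar.prime hp
  have hq2 : 2 ≤ q := by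
    rw [hq]
    exact hp.two_le.trans (Nat.le_self_pow (by omega) p)
  have h0 : ((q + 1 : ℕ) : k) ≠ 0 := by
    rw [Nat.cast_add, hq, Nat.cast_pow, CharP.cast_eq_zero, zero_pow (by omega)]
    simp
  obtain ⟨g, hg⟩ := exists_fermat_equiv q hq2 (iterateFrobenius k p e)
    (fun x => by rw [iterateFrobenius_def, hq]) A hA
  obtain ⟨𝒜, ℬ, hA1, hB1, hD⟩ := fermat_double (k := k) q (by omega) h0
  have hD' := double_map g _ _ _ hD
  have hsub : ∀ L : Submodule k (Fin 4 → k), (L : Set (Fin 4 → k)) ⊆ fermatCone k q →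
      ((Submodule.map g.toLinearMap L : Submodule k (Fin 4 → k)) : Set (Fin 4 → k)) ⊆
        extremalCone k q A := by
    rintro L hL _ ⟨x, hx, rfl⟩
    exact (hg x).trans (hL hx)
  refine ⟨_, _, ?_, ?_, hD'⟩
  · intro M hM
    refine ⟨hD'.2.2.1 M hM, ?_⟩
    obtain ⟨L, hL, rfl⟩ := hM
    exact hsub L (hA1 L hL).2
  · intro M hM
    refine ⟨hD'.2.2.2.1 M hM, ?_⟩
    obtain ⟨L, hL, rfl⟩ := hM
    exact hsub L (hB1 L hL).2
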